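/- For every positive integer n, there exists a frieze pattern f of type A_n, an index i ∈ {1,…,n} and an integer m such that f(i,m) = F_{n+2}; combined with the upper bound, the maximum value occurring in frieze patterns of type A_n is exactly the Fibonacci number F_{n+2}. -/

import Mathlib

/-- A frieze pattern of type `Aₙ`: a function on `{1,…,n} × ℤ` with positive values,
encoded as `f : ℕ × ℤ → ℕ` with the conventions `f (0, m) = f (n+1, m) = 1` and the
diamond rule `f(i,m)·f(i,m+1) = 1 + f(i+1,m)·f(i-1,m+1)` for `1 ≤ i ≤ n`. -/
def IsFriezeA (n : ℕ) (f : ℕ × ℤ → ℕ) : Prop :=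
  (∀ m : ℤ, f (0, m) = 1) ∧
  (∀ m : ℤ, f (n + 1, m) = 1) ∧
  (∀ i : ℕ, 1 ≤ i → i ≤ n → ∀ m : ℤ, 0 < f (i, m)) ∧
  (∀ i : ℕ, 1 ≤ i → i ≤ n → ∀ m : ℤ,
    f (i, m) * f (i, m + 1) = 1 + f (i + 1, m) * f (i - 1, m + 1))

/-- Three-term linear recurrence along a diagonal of a frieze pattern. -/
theorem IsFriezeA.add_eq_mul {n : ℕ} {f : ℕ × ℤ → ℕ} (hf : IsFriezeA n f) (j : ℕ) :
    j + 1 ≤ n → ∀ m : ℤ, f (j, m) + f (j + 2, m) = f (1, m + j + 1) * f (j + 1, m) := by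
  obtain ⟨h0, -, hpos, hd⟩ := hf
  induction j with
  | zero =>
    intro hj m
    have h := hd 1 le_rfl hj m
    simp only [Nat.sub_self, h0, Nat.reduceAdd, mul_one] at h
    simp only [Nat.cast_zero, add_zero, zero_add, h0]
    rw [← h, mul_comm]
  | succ j ih =>
    intro hj m
    have h1 := hd (j + 1) (by omega) (by omega) m
    have h2 := hd (j + 2) (by omega) (by omega) m
    have h3 := ih (by omega) (m + 1)
    have hp := hpos (j + 1) (by omega) (by omega) (m + 1)
    have e : m + ((j + 1 : ℕ) : ℤ) + 1 = m + 1 + j + 1 := by push_cast; ring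
    rw [e]
    simp only [Nat.add_sub_cancel, show j + 2 - 1 = j + 1 by omega,
      show j + 1 + 1 = j + 2 by omega, show j + 2 + 1 = j + 3 by omega] at *
    apply Nat.eq_of_mul_eq_mul_right hp
    zify at *
    linear_combination h1 - h2 + (f (j + 2, m) : ℤ) * h3

/-- A sequence of positive integers with end terms `1`, in which every interior term divides the
sum of its neighbours, is bounded by a Fibonacci number; so are the sums of adjacent terms. -/
theorem le_fib_of_dvd_add (N : ℕ) : ∀ v : ℕ → ℕ, v 0 = 1 → v (N + 1) = 1 →
    (∀ j ≤ N + 1, 0 < v j) → (∀ j < N, v (j + 1) ∣ v j + v (j + 2)) →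
    (∀ j ≤ N + 1, v j ≤ Nat.fib (N + 2)) ∧ ∀ j ≤ N, v j + v (j + 1) ≤ Nat.fib (N + 3) := by
  induction N with
  | zero =>
    intro v h0 h1 _ _
    refine ⟨fun j hj => ?_, fun j hj => ?_⟩
    · interval_cases j <;> simp_all
    · interval_cases j
      simp_all [Nat.fib_add_two]
  | succ N ih =>
    intro v h0 h1 hpos hdvd
    by_cases hone : ∀ j ≤ N + 2, v j ≤ 1
    · have hf3 : 1 ≤ Nat.fib (N + 3) := Nat.fib_pos.2 (by omega)
      have hf2 : 1 ≤ Nat.fib (N + 2) := Nat.fib_pos.2 (by omega)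
      have hf4 : Nat.fib (N + 4) = Nat.fib (N + 2) + Nat.fib (N + 3) := Nat.fib_add_two
      refine ⟨fun j hj => (hone j hj).trans hf3, fun j hj => ?_⟩
      have := hone j (by omega)
      have := hone (j + 1) (by omega)
      change _ ≤ Nat.fib (N + 4)
      omega
    -- Remove the last occurrence of the maximum, which is the sum of its neighbours.
    obtain ⟨i, hi, hvi, hmax, hlast⟩ : ∃ i ≤ N + 2, 1 < v i ∧ (∀ j ≤ N + 2, v j ≤ v i) ∧
        ∀ j ≤ N + 2, i < j → v j < v i := by
      obtain ⟨i, hi, hmax⟩ := (Finset.range (N + 3)).exists_max_image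
        (fun j => toLex (v j, j)) ⟨0, by simp⟩
      simp only [Finset.mem_range, Prod.Lex.toLex_le_toLex] at hi hmax
      push Not at hone
      obtain ⟨k, hk, hk1⟩ := hone
      refine ⟨i, by omega, ?_, fun j hj => ?_, fun j hj hij => ?_⟩
      · have := hmax k (by omega)
        omega
      · have := hmax j (by omega)
        omega
      · have := hmax j (by omega)
        omega
    have hi0 : i ≠ 0 := by rintro rfl; omega
    have hiN : i ≠ N + 2 := by rintro rfl; change v (N + 2) = 1 at h1; omega
    obtain ⟨k, rfl⟩ := Nat.exists_eq_succ_of_ne_zero hi0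
    simp only [Nat.succ_eq_add_one] at *
    have hsum : v k + v (k + 2) = v (k + 1) := by
      obtain ⟨c, hc⟩ := hdvd k (by omega)
      have ha := hmax k (by omega)
      have hb := hlast (k + 2) (by omega) (by omega)
      have hp := hpos k (by omega)
      have hc2 : c < 2 := by
        by_contra! h
        have := Nat.mul_le_mul_left (v (k + 1)) h
        omega
      interval_cases c <;> omega
    have hlt : ∀ j ≤ k, (if j ≤ k then v j else v (j + 1)) = v j := fun j hj => if_pos hj
    have hge : ∀ j, k < j → (if j ≤ k then v j else v (j + 1)) = v (j + 1) :=
      fun j hj => if_neg (by omega)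
    obtain ⟨hA, hB⟩ := ih (fun j => if j ≤ k then v j else v (j + 1)) (by simpa using h0)
      (by rw [hge _ (by omega)]; exact h1)
      (fun j hj => by split_ifs <;> exact hpos _ (by omega))
      (fun j hj => by
        rcases lt_trichotomy (j + 1) k with h | h | h
        · rw [hlt _ h.le, hlt j (by omega), hlt (j + 2) (by omega)]
          exact hdvd j (by omega)
        · subst h
          rw [hlt _ le_rfl, hlt j (by omega), hge (j + 2) (by omega)]
          have := hdvd j (by omega)
          rw [← hsum, add_left_comm] at this
          exact (Nat.dvd_add_right dvd_rfl).1 this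
        · rw [hge _ h, hge (j + 2) (by omega)]
          have := hdvd (j + 1) (by omega)
          rcases eq_or_lt_of_le (Nat.lt_succ_iff.1 h) with h' | h'
          · subst h'
            rw [hlt _ le_rfl]
            rw [← hsum, add_right_comm (v k)] at this
            exact (Nat.dvd_add_left dvd_rfl).1 this
          · rw [hge _ h']
            exact this)
    have hk : v (k + 1) ≤ Nat.fib (N + 3) := by
      have := hB k (by omega)
      rw [hlt _ le_rfl, hge _ (by omega), hsum] at this
      exact this
    have hall : ∀ j ≤ N + 2, j ≠ k + 1 → v j ≤ Nat.fib (N + 2) := by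
      intro j hj hne
      rcases Nat.lt_or_gt_of_ne hne with h | h
      · have := hA j (by omega)
        rwa [hlt _ (by omega)] at this
      · obtain ⟨j, rfl⟩ := Nat.exists_eq_succ_of_ne_zero (show j ≠ 0 by omega)
        have := hA j (by omega)
        rwa [hge _ (by omega)] at this
    have hf4 : Nat.fib (N + 4) = Nat.fib (N + 2) + Nat.fib (N + 3) := Nat.fib_add_two
    have hf3 : Nat.fib (N + 3) = Nat.fib (N + 1) + Nat.fib (N + 2) := Nat.fib_add_two
    have hf2 : Nat.fib (N + 2) ≤ Nat.fib (N + 3) := Nat.fib_mono (by omega)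
    refine ⟨fun j hj => ?_, fun j hj => ?_⟩
    · change v j ≤ Nat.fib (N + 3)
      by_cases h : j = k + 1
      · rw [h]; exact hk
      · exact (hall j hj h).trans hf2
    · change v j + v (j + 1) ≤ Nat.fib (N + 4)
      by_cases h : j = k + 1
      · subst h
        have := hall (k + 1 + 1) (by omega) (by omega)
        omega
      by_cases h' : j = k
      · subst h'
        have := hall j (by omega) h
        omega
      have := hall j (by omega) h
      have := hall (j + 1) (by omega) (by omega)
      omega

/-- An antiperiodic sequence of integer vectors in convex position, with consecutive vectors
spanning a parallelogram of area `1`, gives a frieze pattern whose entries are determinants. -/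
theorem isFriezeA_of_det (n : ℕ) (x y : ℤ → ℤ)
    (hx : ∀ m, x (m + (n + 3)) = -x m) (hy : ∀ m, y (m + (n + 3)) = -y m)
    (hone : ∀ m, x m * y (m + 1) - y m * x (m + 1) = 1)
    (hpos : ∀ m k : ℤ, 0 < k → k < n + 3 → 0 < x m * y (m + k) - y m * x (m + k)) :
    IsFriezeA n fun p => (x p.2 * y (p.2 + (p.1 + 1)) - y p.2 * x (p.2 + (p.1 + 1))).toNat := by
  refine ⟨fun m => ?_, fun m => ?_, fun i _ hi m => ?_, fun i hi1 hi m => ?_⟩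
  · simp [hone]
  · have e : m + (((n + 1 : ℕ) : ℤ) + 1) = m - 1 + (n + 3) := by push_cast; ring
    have h := hone (m - 1)
    rw [sub_add_cancel] at h
    simp only [e, hx, hy]
    rw [show x m * -y (m - 1) - y m * -x (m - 1) = 1 by linear_combination h]
    rfl
  · have := hpos m (i + 1) (by omega) (by omega)
    dsimp only
    omega
  · obtain ⟨j, rfl⟩ := Nat.exists_eq_succ_of_ne_zero (show i ≠ 0 by omega)
    have p1 := hpos m (j + 2) (by omega) (by omega)
    have p2 := hpos (m + 1) (j + 2) (by omega) (by omega)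
    have p3 := hpos m (j + 3) (by omega) (by omega)
    have p4 := hpos (m + 1) (j + 1) (by omega) (by omega)
    have q1 := hone m
    have q2 := hone (m + (j + 2))
    rw [show m + 1 + ((j : ℤ) + 2) = m + (j + 3) by ring] at p2
    rw [show m + 1 + ((j : ℤ) + 1) = m + (j + 2) by ring] at p4
    rw [show m + ((j : ℤ) + 2) + 1 = m + (j + 3) by ring] at q2
    simp only [Nat.succ_eq_add_one, Nat.add_sub_cancel]
    push_cast
    rw [show m + ((j : ℤ) + 1 + 1) = m + (j + 2) by ring,
      show m + 1 + ((j : ℤ) + 1 + 1) = m + (j + 3) by ring,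
      show m + ((j : ℤ) + 1 + 1 + 1) = m + (j + 3) by ring,
      show m + 1 + ((j : ℤ) + 1) = m + (j + 2) by ring]
    zify
    rw [Int.toNat_of_nonneg p1.le, Int.toNat_of_nonneg p2.le, Int.toNat_of_nonneg p3.le,
      Int.toNat_of_nonneg p4.le]
    linear_combination
      (x (m + (j + 2)) * y (m + (j + 3)) - y (m + (j + 2)) * x (m + (j + 3))) * q1 + q2

/-- Extend a sequence of length `N` to an antiperiodic sequence indexed by `ℤ`. -/
def antiperiodicExtension (N : ℕ) (w : ℕ → ℤ) (m : ℤ) : ℤ :=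
  ((-1 : ℤˣ) ^ (m / N) : ℤˣ) * w (m % N).toNat

theorem antiperiodicExtension_add {N : ℕ} (hN : 0 < N) (w : ℕ → ℤ) (m : ℤ) :
    antiperiodicExtension N w (m + N) = -antiperiodicExtension N w m := by
  have hN' : (N : ℤ) ≠ 0 := by omega
  simp [antiperiodicExtension, Int.add_ediv_of_dvd_right, Int.ediv_self hN', zpow_add]

theorem det_antiperiodicExtension {N : ℕ} {x y : ℕ → ℤ} {m k : ℤ} (hk : 0 < k) (hkN : k < N) :
    ∃ a b : ℕ, a < b ∧ b < N ∧ ((b : ℤ) = a + k ∨ (b : ℤ) + k = a + N) ∧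
      antiperiodicExtension N x m * antiperiodicExtension N y (m + k) -
        antiperiodicExtension N y m * antiperiodicExtension N x (m + k) =
      x a * y b - y a * x b := by
  have hN : (0 : ℤ) < N := by omega
  have h0 := Int.emod_nonneg m hN.ne'
  have h1 := Int.emod_lt_of_pos m hN
  have h2 := Int.mul_ediv_add_emod m N
  have hs : ∀ q : ℤ, (((-1 : ℤˣ) ^ q : ℤˣ) : ℤ) * (((-1 : ℤˣ) ^ q : ℤˣ) : ℤ) = 1 := by
    intro q
    rw [← Units.val_mul, Int.units_mul_self, Units.val_one]
  have hsq := hs (m / N)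
  set q := m / (N : ℤ) with hq
  set r := m % (N : ℤ) with hr
  rcases lt_or_ge (r + k) N with h | h
  · obtain ⟨e1, e2⟩ : (m + k) / N = q ∧ (m + k) % N = r + k :=
      (Int.ediv_emod_unique hN).2 ⟨by linarith, by omega, h⟩
    refine ⟨r.toNat, (r + k).toNat, by omega, by omega, by omega, ?_⟩
    simp only [antiperiodicExtension, e1, e2, ← hq, ← hr]
    linear_combination
      (x r.toNat * y (r + k).toNat - y r.toNat * x (r + k).toNat) * hsq
  · obtain ⟨e1, e2⟩ : (m + k) / N = q + 1 ∧ (m + k) % N = r + k - N :=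
      (Int.ediv_emod_unique hN).2 ⟨by linarith, by omega, by omega⟩
    refine ⟨(r + k - N).toNat, r.toNat, by omega, by omega, by omega, ?_⟩
    simp only [antiperiodicExtension, e1, e2, ← hq, ← hr, zpow_add, zpow_one, Units.val_mul,
      Units.val_neg, Units.val_one]
    linear_combination
      (y r.toNat * x (r + k - N).toNat - x r.toNat * y (r + k - N).toNat) * hsq

/-- The order in which the vectors `(fib (s + 1), fib s)`, `s < N`, are met when rotating
counterclockwise: first the even indices increasingly, then the odd ones decreasingly. -/
def fibRotationIndex (N p : ℕ) : ℕ := if 2 * p < N then 2 * p else 2 * N - 1 - 2 * p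

theorem fib_det (s k : ℕ) :
    (Nat.fib (s + 1) * Nat.fib (s + k) - Nat.fib s * Nat.fib (s + k + 1) : ℤ) =
      (-1) ^ s * Nat.fib k := by
  induction s with
  | zero => simp
  | succ s ih =>
    rw [show s + 1 + k = s + k + 1 by ring, pow_succ]
    have h1 : Nat.fib (s + 1 + 1) = Nat.fib s + Nat.fib (s + 1) := Nat.fib_add_two
    have h2 : Nat.fib (s + k + 1 + 1) = Nat.fib (s + k) + Nat.fib (s + k + 1) := Nat.fib_add_two
    rw [h1, h2]
    push_cast
    linear_combination -ih

theorem fib_det_of_even {s t : ℕ} (hs : Even s) (h : s ≤ t) :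
    (Nat.fib (s + 1) * Nat.fib t - Nat.fib s * Nat.fib (t + 1) : ℤ) = Nat.fib (t - s) := by
  obtain ⟨k, rfl⟩ := Nat.exists_eq_add_of_le h
  rw [fib_det, hs.neg_one_pow, one_mul, Nat.add_sub_cancel_left]

theorem fib_det_of_odd {s t : ℕ} (ht : Odd t) (h : t ≤ s) :
    (Nat.fib (s + 1) * Nat.fib t - Nat.fib s * Nat.fib (t + 1) : ℤ) = Nat.fib (s - t) := by
  obtain ⟨k, rfl⟩ := Nat.exists_eq_add_of_le h
  have := fib_det t k
  rw [ht.neg_one_pow] at this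
  rw [Nat.add_sub_cancel_left]
  linear_combination -this

theorem fib_det_fibRotationIndex {N a b : ℕ} (hab : a < b) (hb : b < N) :
    ∃ k : ℕ, 0 < k ∧ (b = a + 1 ∨ b + 1 = a + N → k ≤ 2) ∧
      (Nat.fib (fibRotationIndex N a + 1) * Nat.fib (fibRotationIndex N b) -
        Nat.fib (fibRotationIndex N a) * Nat.fib (fibRotationIndex N b + 1) : ℤ) = Nat.fib k := by
  unfold fibRotationIndex
  by_cases ha2 : 2 * a < N
  · rw [if_pos ha2]
    by_cases hb2 : 2 * b < N
    · rw [if_pos hb2]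
      exact ⟨_, by omega, by omega, fib_det_of_even (even_two_mul a) (by omega)⟩
    · rw [if_neg hb2]
      rcases le_total (2 * a) (2 * N - 1 - 2 * b) with h | h
      · exact ⟨_, by omega, by omega, fib_det_of_even (even_two_mul a) h⟩
      · exact ⟨_, by omega, by omega, fib_det_of_odd (Nat.odd_iff.2 (by omega)) h⟩
  · rw [if_neg ha2, if_neg (by omega)]
    exact ⟨_, by omega, by omega, fib_det_of_odd (Nat.odd_iff.2 (by omega)) (by omega)⟩

theorem exists_isFriezeA_eq_fib (n : ℕ) (hn : 0 < n) : ∃ f : ℕ × ℤ → ℕ, IsFriezeA n f ∧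
    ∃ i : ℕ, 1 ≤ i ∧ i ≤ n ∧ ∃ m : ℤ, f (i, m) = Nat.fib (n + 2) := by
  let u : ℕ → ℤ := fun p => Nat.fib (fibRotationIndex (n + 3) p + 1)
  let v : ℕ → ℤ := fun p => Nat.fib (fibRotationIndex (n + 3) p)
  have key : ∀ m k : ℤ, 0 < k → k < (n + 3 : ℕ) → ∃ l : ℕ, 0 < l ∧ (k = 1 → l ≤ 2) ∧
      antiperiodicExtension (n + 3) u m * antiperiodicExtension (n + 3) v (m + k) -
        antiperiodicExtension (n + 3) v m * antiperiodicExtension (n + 3) u (m + k) =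
        Nat.fib l := by
    intro m k hk hkn
    obtain ⟨a, b, hab, hb, hk', h⟩ := det_antiperiodicExtension (x := u) (y := v) (m := m) hk hkn
    obtain ⟨l, hl, hl2, h'⟩ := fib_det_fibRotationIndex hab hb
    exact ⟨l, hl, fun hk1 => hl2 (by omega), h.trans h'⟩
  refine ⟨_, isFriezeA_of_det n (antiperiodicExtension (n + 3) u) (antiperiodicExtension (n + 3) v)
    (fun m => by simpa using antiperiodicExtension_add (by omega : 0 < n + 3) u m)
    (fun m => by simpa using antiperiodicExtension_add (by omega : 0 < n + 3) v m)
    (fun m => ?_) (fun m k hk hkn => ?_), (n + 3) / 2 - 1, by omega, by omega, 0, ?_⟩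
  · obtain ⟨l, hl, hl2, h⟩ := key m 1 one_pos (by omega)
    rw [h]
    have := hl2 rfl
    interval_cases l <;> rfl
  · obtain ⟨l, hl, -, h⟩ := key m k hk (by omega)
    rw [h]
    exact_mod_cast Nat.fib_pos.2 hl
  · have hb : (0 : ℤ) + (((n + 3) / 2 - 1 : ℕ) + 1) = ((n + 3) / 2 : ℕ) := by omega
    have hd : (((n + 3) / 2 : ℕ) : ℤ) / (n + 3 : ℕ) = 0 :=
      Int.ediv_eq_zero_of_lt (by omega) (by omega)
    have hm : (((n + 3) / 2 : ℕ) : ℤ) % (n + 3 : ℕ) = ((n + 3) / 2 : ℕ) :=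
      Int.emod_eq_of_lt (by omega) (by omega)
    have h0 : fibRotationIndex (n + 3) 0 = 0 := by simp [fibRotationIndex]
    have hi : fibRotationIndex (n + 3) ((n + 3) / 2) = n + 2 := by
      unfold fibRotationIndex
      split_ifs <;> omega
    simp only [hb, antiperiodicExtension, hd, hm, Int.zero_ediv, Int.zero_emod, zpow_zero,
      Units.val_one, one_mul, Int.toNat_zero, Int.toNat_natCast, u, v, h0, hi]
    simp

/-- The maximum value occurring in frieze patterns of type `Aₙ` is exactly the
Fibonacci number `F (n+2)`: every value is at most `F (n+2)`, and some frieze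
pattern of type `Aₙ` attains the value `F (n+2)`. -/
theorem frieze_A_max_eq_fib (n : ℕ) (hn : 0 < n) :
    (∀ f : ℕ × ℤ → ℕ, IsFriezeA n f →
      ∀ i : ℕ, 1 ≤ i → i ≤ n → ∀ m : ℤ, f (i, m) ≤ Nat.fib (n + 2)) ∧
    (∃ f : ℕ × ℤ → ℕ, IsFriezeA n f ∧
      ∃ i : ℕ, 1 ≤ i ∧ i ≤ n ∧ ∃ m : ℤ, f (i, m) = Nat.fib (n + 2)) := by
  refine ⟨fun f hf i _ hi m => ?_, exists_isFriezeA_eq_fib n hn⟩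
  refine (le_fib_of_dvd_add n (fun j => f (j, m)) (hf.1 m) (hf.2.1 m) (fun j hj => ?_)
    (fun j hj => ?_)).1 i (by omega)
  · rcases Nat.eq_zero_or_pos j with rfl | h
    · simp [hf.1 m]
    rcases Nat.lt_or_ge n j with h' | h'
    · obtain rfl : j = n + 1 := by omega
      simp [hf.2.1 m]
    · exact hf.2.2.1 j h h' m
  · exact ⟨_, (hf.add_eq_mul j hj m).trans (mul_comm _ _)⟩
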